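/- Let G be an infinite weighted graph with a fixed vertex o, let g₀ := limsup_n w_n^{1/n} be its exponential upper growth, and set g := max(g₀, 1). Then the random walk (X_k) on G started at o satisfies limsup_{k→∞} |X_k|/k ≤ (g−1)/(g+1) almost surely, where |v| := dist(o,v). -/

import Mathlib

open MeasureTheory Filter
open scoped Classical ENNReal

namespace RWHitting

/-- A weighted graph on a vertex set `V`: a symmetric weight function with
positive finite vertex weights. -/
structure WeightedGraph (V : Type*) where
  w : V → V → ℝ≥0∞
  symm : ∀ x y, w x y = w y x
  vw_pos : ∀ x, 0 < ∑' y, w x y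
  vw_lt_top : ∀ x, ∑' y, w x y < ⊤

namespace WeightedGraph

variable {V : Type*}

/-- The weight of a vertex. -/
noncomputable def vw (G : WeightedGraph V) (x : V) : ℝ≥0∞ := ∑' y, G.w x y

/-- The weight of a vertex set. -/
noncomputable def setWeight (G : WeightedGraph V) (z : Set V) : ℝ≥0∞ := ∑' x : z, G.vw x

/-- `G.distGE o z m` : every path of positive-weight steps from `o` into `z` has length `≥ m`. -/
def distGE (G : WeightedGraph V) (o : V) (z : Set V) (m : ℕ) : Prop :=
  ∀ (k : ℕ) (p : ℕ → V), p 0 = o → (∀ i, i < k → 0 < G.w (p i) (p (i+1))) → p k ∈ z → m ≤ k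

/-- Transition probabilities of the random walk on `G`. -/
noncomputable def trans (G : WeightedGraph V) (x y : V) : ℝ≥0∞ := G.w x y / G.vw x

/-- Graph distance (as an extended nonneg real). -/
noncomputable def edist (G : WeightedGraph V) (x y : V) : ℝ≥0∞ :=
  ⨅ (k : ℕ) (_ : ∃ p : ℕ → V, p 0 = x ∧ p k = y ∧ ∀ i, i < k → 0 < G.w (p i) (p (i+1))),
    (k : ℝ≥0∞)

/-- Total weight of the edges at distance `n` from `o` (each non-loop edge counted in both
orientations). -/
noncomputable def boundaryWeight (G : WeightedGraph V) (o : V) (n : ℕ) : ℝ≥0∞ :=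
  ∑' q : V × V, if min (G.edist o q.1) (G.edist o q.2) = (n : ℝ≥0∞) then G.w q.1 q.2 else 0

end WeightedGraph

variable {V : Type*}

/-- `μ` is the law of the random walk on `G` started at `o`. -/
def IsRandomWalk [MeasurableSpace V] (G : WeightedGraph V) (o : V)
    (μ : Measure (ℕ → V)) : Prop :=
  IsProbabilityMeasure μ ∧
  ∀ (k : ℕ) (x : Fin (k+1) → V),
    μ {ω | ∀ i : Fin (k+1), ω (i : ℕ) = x i}
      = (if x 0 = o then 1 else 0) * ∏ i : Fin k, G.trans (x i.castSucc) (x i.succ)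

/-- First hitting time of the set `z` (`∞` if `z` is never visited). -/
noncomputable def hitTime (z : Set V) (ω : ℕ → V) : ℝ≥0∞ :=
  ⨅ (k : ℕ) (_ : ω k ∈ z), (k : ℝ≥0∞)

/-- Expected hitting time of `z`. -/
noncomputable def expHit [MeasurableSpace V] (μ : Measure (ℕ → V)) (z : Set V) : ℝ≥0∞ :=
  ∫⁻ ω, hitTime z ω ∂μ

/-- Number of visits to `o` (counting time 0) strictly before hitting `z`. -/
noncomputable def visitsBefore (z : Set V) (o : V) (ω : ℕ → V) : ℝ≥0∞ :=
  ∑' k : ℕ, if ω k = o ∧ (k : ℝ≥0∞) < hitTime z ω then 1 else 0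

/-- Effective resistance between `o` and `z`, defined probabilistically via the random walk
law `μ`:  `w_o r_{oz}` is the expected number of visits to `o` before hitting `z`. -/
noncomputable def resistance [MeasurableSpace V] (G : WeightedGraph V) (o : V) (z : Set V)
    (μ : Measure (ℕ → V)) : ℝ≥0∞ :=
  (∫⁻ ω, visitsBefore z o ω ∂μ) / G.vw o

/-- One-step transition probabilities for the biased simple random walk on `ℤ`
with odds `1 : g` of going left/right. -/
noncomputable def biasedStep (g : ℝ) (a b : ℤ) : ℝ≥0∞ :=
  if b = a + 1 then ENNReal.ofReal (g / (g+1))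
  else if b = a - 1 then ENNReal.ofReal (1 / (g+1)) else 0

/-- `ν` is the law of the biased simple random walk on `ℤ` started at `0`,
stepping right with probability `g/(g+1)` and left with probability `1/(g+1)`. -/
def IsBiasedWalk (g : ℝ) (ν : Measure (ℕ → ℤ)) : Prop :=
  IsProbabilityMeasure ν ∧
  ∀ (k : ℕ) (x : Fin (k+1) → ℤ),
    ν {ω | ∀ i : Fin (k+1), ω (i : ℕ) = x i}
      = (if x 0 = 0 then 1 else 0) * ∏ i : Fin k, biasedStep g (x i.castSucc) (x i.succ)

/-- `e^{-λ t}` for an extended-real time `t`, with the convention `e^{-λ ∞} = 0`. -/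
noncomputable def expNeg (lam : ℝ) (t : ℝ≥0∞) : ℝ≥0∞ :=
  if t = ⊤ then 0 else ENNReal.ofReal (Real.exp (-lam * t.toReal))


theorem weighted_edge_inequality {ℓ κ β γ a b : ℝ} (hβ : 0 < β) (hβ1 : β < 1)
    (h1 : (1 - β) * Real.exp κ + β * Real.exp (-κ - ℓ) ≤ Real.exp γ)
    (h2 : (1 - β) * Real.exp (-κ) + β * Real.exp (κ + ℓ) ≤ Real.exp γ)
    (ha : 0 ≤ a) (hb : 0 ≤ b) :
    Real.exp (κ + β * ℓ) * (a ^ (1 - β) * b ^ β)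
      + Real.exp (-(κ + β * ℓ)) * (b ^ (1 - β) * a ^ β) ≤ Real.exp γ * (a + b) := by
  have hb' : 0 ≤ Real.exp ℓ * b := by positivity
  have e1 : a ^ (1 - β) * (Real.exp ℓ * b) ^ β ≤ (1 - β) * a + β * (Real.exp ℓ * b) :=
    Real.geom_mean_le_arith_mean2_weighted (by linarith) hβ.le ha hb' (by ring)
  have e2 : (Real.exp ℓ * b) ^ (1 - β) * a ^ β ≤ (1 - β) * (Real.exp ℓ * b) + β * a :=
    Real.geom_mean_le_arith_mean2_weighted (by linarith) hβ.le hb' ha (by ring)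
  rw [Real.mul_rpow (Real.exp_pos _).le hb, ← Real.exp_mul] at e1 e2
  have f1 : Real.exp (κ + β * ℓ) = Real.exp κ * Real.exp (ℓ * β) := by
    rw [← Real.exp_add]; ring_nf
  have f2 : Real.exp (-(κ + β * ℓ)) = Real.exp (-κ - ℓ) * Real.exp (ℓ * (1 - β)) := by
    rw [← Real.exp_add]; ring_nf
  have f3 : Real.exp (κ + ℓ) = Real.exp κ * Real.exp ℓ := Real.exp_add _ _
  have f4 : Real.exp (-κ) = Real.exp (-κ - ℓ) * Real.exp ℓ := by
    rw [← Real.exp_add]; ring_nf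
  rw [f1, f2]
  rw [f3, f4] at h2
  have g1 := mul_le_mul_of_nonneg_left e1 (Real.exp_pos κ).le
  have g2 := mul_le_mul_of_nonneg_left e2 (Real.exp_pos (-κ - ℓ)).le
  have g3 := mul_le_mul_of_nonneg_right h1 ha
  have g4 := mul_le_mul_of_nonneg_right h2 hb
  linarith

theorem geom_symm_le {β a b : ℝ} (hβ : 0 < β) (hβ1 : β < 1) (ha : 0 ≤ a) (hb : 0 ≤ b) :
    a ^ (1 - β) * b ^ β + b ^ (1 - β) * a ^ β ≤ a + b := by
  have e1 : a ^ (1 - β) * b ^ β ≤ (1 - β) * a + β * b :=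
    Real.geom_mean_le_arith_mean2_weighted (by linarith) hβ.le ha hb (by ring)
  have e2 : b ^ (1 - β) * a ^ β ≤ (1 - β) * b + β * a :=
    Real.geom_mean_le_arith_mean2_weighted (by linarith) hβ.le hb ha (by ring)
  linarith

/-- A perturbative choice of tilting parameters: the cost `γ` stays below `κ * v` as soon as `v`
exceeds the speed `(g - 1) / (g + 1)` of the biased walk. -/
theorem exists_tilting_parameters {g v : ℝ} (hg : 1 < g) (hv : (g - 1) / (g + 1) < v) :
    ∃ κ β γ : ℝ, 0 < κ ∧ 0 < β ∧ β < 1 ∧ 0 ≤ γ ∧ γ < κ * v ∧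
      (1 - β) * Real.exp κ + β * Real.exp (-κ - Real.log g) ≤ Real.exp γ ∧
      (1 - β) * Real.exp (-κ) + β * Real.exp (κ + Real.log g) ≤ Real.exp γ := by
  set s := (g - 1) / (g + 1) with hs
  have hg0 : 0 < g := by linarith
  have hg1 : 0 < g + 1 := by linarith
  have hgg : 0 < g ^ 2 - 1 := by nlinarith
  set b := 2 * g / (g ^ 2 - 1) with hb
  have hb0 : 0 < b := by positivity
  have hs0 : 0 < s := div_pos (by linarith) hg1
  set C := 1 + b * (1 + 2 * g) with hC
  have hC0 : 0 < C := by positivity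
  obtain ⟨κ, hκ0, hκ⟩ : ∃ κ : ℝ, 0 < κ ∧ κ < min (min 1 (1 / b)) ((v - s) / C) :=
    exists_between (lt_min (lt_min one_pos (by positivity)) (div_pos (by linarith) hC0))
  simp only [lt_min_iff, lt_div_iff₀ hb0, lt_div_iff₀ hC0] at hκ
  obtain ⟨⟨hκ1, hκb⟩, hκC⟩ := hκ
  have hexp : Real.exp κ ≤ 1 + κ + κ ^ 2 := by
    have := Real.abs_exp_sub_one_sub_id_le (x := κ) (by rw [abs_of_pos hκ0]; exact hκ1.le)
    linarith [(abs_le.1 this).2]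
  have hexp' : Real.exp (-κ) ≤ 1 - κ + κ ^ 2 := by
    have := Real.abs_exp_sub_one_sub_id_le (x := -κ) (by rw [abs_neg, abs_of_pos hκ0]; exact hκ1.le)
    have := (abs_le.1 this).2
    nlinarith
  have hexp1 : Real.exp (-κ) ≤ 1 := Real.exp_le_one_iff.2 (by linarith)
  have hbs1 : b * (1 - 1 / g) = 1 - s := by rw [hb, hs]; field_simp; ring
  have hbs2 : b * (g - 1) = 1 + s := by rw [hb, hs]; field_simp; ring
  refine ⟨κ, b * κ, κ * s + C * κ ^ 2, hκ0, by positivity, by linarith, by positivity,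
    by nlinarith, ?_, ?_⟩
  · refine le_trans ?_ (Real.add_one_le_exp _)
    rw [sub_eq_add_neg (-κ), Real.exp_add, Real.exp_neg (Real.log g), Real.exp_log hg0]
    have t1 : (1 - b * κ) * Real.exp κ ≤ (1 - b * κ) * (1 + κ + κ ^ 2) :=
      mul_le_mul_of_nonneg_left hexp (by linarith)
    have t2 : b * κ * (Real.exp (-κ) * g⁻¹) ≤ b * κ * (1 * g⁻¹) := by gcongr
    have t3 : b * κ * (1 * g⁻¹) = b * κ - κ * (1 - s) := by rw [← hbs1]; field_simp; ring
    have t4 : κ ^ 2 ≤ C * κ ^ 2 := by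
      have : 1 ≤ C := by rw [hC]; nlinarith [mul_pos hb0 hg0]
      nlinarith [sq_nonneg κ]
    have t5 : 0 ≤ b * κ * (κ + κ ^ 2) := by positivity
    nlinarith
  · refine le_trans ?_ (Real.add_one_le_exp _)
    rw [Real.exp_add, Real.exp_log hg0]
    have t1 : (1 - b * κ) * Real.exp (-κ) ≤ (1 - b * κ) * (1 - κ + κ ^ 2) :=
      mul_le_mul_of_nonneg_left hexp' (by linarith)
    have t2 : b * κ * (Real.exp κ * g) ≤ b * κ * ((1 + κ + κ ^ 2) * g) := by gcongr
    have t3 : b * κ * g = b * κ + κ * (1 + s) := by rw [← hbs2]; ring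
    have t4 : b * g * κ ^ 3 ≤ b * g * κ ^ 2 := by
      have : κ ^ 3 ≤ κ ^ 2 := pow_le_pow_of_le_one hκ0.le hκ1.le (by norm_num)
      gcongr
    have t5 : 0 ≤ b * κ ^ 3 := by positivity
    rw [hC]
    nlinarith

namespace WeightedGraph

theorem vw_ne_zero (G : WeightedGraph V) (x : V) : G.vw x ≠ 0 := (G.vw_pos x).ne'

theorem vw_ne_top (G : WeightedGraph V) (x : V) : G.vw x ≠ ⊤ := (G.vw_lt_top x).ne

/-- An edge function whose symmetrization is dominated by that of a vertex function has smaller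
total weight. -/
theorem tsum_edge_le (G : WeightedGraph V) (B : V → V → ℝ≥0∞) (u : V → ℝ≥0∞)
    (h : ∀ x y, G.w x y ≠ 0 → B x y + B y x ≤ u x + u y) :
    ∑' x, ∑' y, G.w x y * B x y ≤ ∑' x, G.vw x * u x := by
  have hB : ∑' x, ∑' y, G.w x y * B y x = ∑' x, ∑' y, G.w x y * B x y := by
    rw [ENNReal.tsum_comm]
    simp_rw [fun x y => G.symm x y]
  have hu : ∑' x, ∑' y, G.w x y * u x = ∑' x, G.vw x * u x := by
    simp_rw [ENNReal.tsum_mul_right, vw]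
  have hu' : ∑' x, ∑' y, G.w x y * u y = ∑' x, G.vw x * u x := by
    rw [ENNReal.tsum_comm, ← hu]
    simp_rw [fun x y => G.symm x y]
  have key : ∑' x, ∑' y, G.w x y * (B x y + B y x) ≤ ∑' x, ∑' y, G.w x y * (u x + u y) := by
    refine ENNReal.tsum_le_tsum fun x => ENNReal.tsum_le_tsum fun y => ?_
    by_cases hw : G.w x y = 0
    · simp [hw]
    · exact mul_le_mul_right (h x y hw) _
  simp_rw [mul_add, ENNReal.tsum_add] at key
  rw [hB, hu, hu', ← two_mul, ← two_mul] at key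
  exact (ENNReal.mul_le_mul_iff_right two_ne_zero ENNReal.ofNat_ne_top).1 key

end WeightedGraph

theorem IsRandomWalk.ae_start [Countable V] [MeasurableSpace V] {G : WeightedGraph V} {o : V}
    {μ : Measure (ℕ → V)} (hμ : IsRandomWalk G o μ) : ∀ᵐ ω ∂μ, ω 0 = o := by
  have h : ∀ᵐ ω ∂μ, ∀ x : V, x ≠ o → ω 0 ≠ x := by
    refine ae_all_iff.2 fun x => ?_
    by_cases hx : x = o
    · simp [hx]
    · have := hμ.2 0 (fun _ => x)
      simp only [hx, if_false, zero_mul] at this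
      refine measure_mono_null (fun ω hω => ?_) this
      simpa [hx] using hω
  filter_upwards [h] with ω hω
  by_contra hne
  exact hω _ hne rfl

section Markov

variable [Countable V] [MeasurableSpace V] [MeasurableSingletonClass V]

theorem lintegral_initial_segment (μ : Measure (ℕ → V)) (n : ℕ)
    (F : (Fin (n + 1) → V) → ℝ≥0∞) :
    ∫⁻ ω, F (fun i => ω i) ∂μ
      = ∑' x, F x * μ {ω | ∀ i : Fin (n + 1), ω (i : ℕ) = x i} := by
  have hm : Measurable (fun (ω : ℕ → V) (i : Fin (n + 1)) => ω i) := by fun_prop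
  rw [← lintegral_map (μ := μ) (f := F) (Measurable.of_discrete) hm, lintegral_countable']
  refine tsum_congr fun x => ?_
  rw [Measure.map_apply hm (measurableSet_singleton x)]
  congr 2
  ext ω
  simp [funext_iff]

namespace IsRandomWalk

variable {G : WeightedGraph V} {o : V} {μ : Measure (ℕ → V)}

theorem lintegral_mul_step (hμ : IsRandomWalk G o μ) (n : ℕ)
    (F : (Fin (n + 1) → V) → ℝ≥0∞) (k : V → V → ℝ≥0∞) :
    ∫⁻ ω, F (fun i => ω i) * k (ω n) (ω (n + 1)) ∂μ
      = ∫⁻ ω, F (fun i => ω i) * ∑' y, G.trans (ω n) y * k (ω n) y ∂μ := by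
  have h1 := lintegral_initial_segment μ (n + 1)
    (fun x => F (fun i => x i.castSucc) * k (x (Fin.last n).castSucc) (x (Fin.last (n + 1))))
  have h2 := lintegral_initial_segment μ n
    (fun x => F x * ∑' y, G.trans (x (Fin.last n)) y * k (x (Fin.last n)) y)
  simp only [Fin.val_castSucc, Fin.val_last] at h1 h2
  rw [h1, h2, ← (Fin.snocEquiv (fun _ : Fin (n + 2) => V)).tsum_eq, ENNReal.tsum_prod',
    ENNReal.tsum_comm]
  refine tsum_congr fun x => ?_
  simp_rw [hμ.2]
  rw [mul_assoc, mul_comm (∑' y, _), ← ENNReal.tsum_mul_left, ← ENNReal.tsum_mul_left]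
  refine tsum_congr fun y => ?_
  have h0 : (Fin.snoc x y : Fin (n + 2) → V) 0 = x 0 := by
    rw [← Fin.castSucc_zero, Fin.snoc_castSucc]
  rw [Fin.prod_univ_castSucc]
  simp only [Fin.snocEquiv, Equiv.coe_fn_mk, Fin.snoc_castSucc, Fin.snoc_last, h0,
    Fin.succ_castSucc, Fin.succ_last]
  ring

theorem lintegral_prod_le_one (hμ : IsRandomWalk G o μ) (k : V → V → ℝ≥0∞)
    (hk : ∀ x, ∑' y, G.trans x y * k x y ≤ 1) (n : ℕ) :
    ∫⁻ ω, ∏ i ∈ Finset.range n, k (ω i) (ω (i + 1)) ∂μ ≤ 1 := by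
  have := hμ.1
  induction n with
  | zero => simp
  | succ n ih =>
    have h := hμ.lintegral_mul_step n
      (fun x => ∏ i : Fin n, k (x i.castSucc) (x i.succ)) k
    simp only [Fin.val_castSucc, Fin.val_succ] at h
    simp_rw [Finset.prod_range_succ]
    simp only [Finset.prod_range] at ih ⊢
    rw [h]
    refine le_trans (lintegral_mono fun ω => ?_) ih
    exact mul_le_of_le_one_right (zero_le) (hk _)

end IsRandomWalk

end Markov

section Occupation

variable [MeasurableSpace V]

/-- The expected number of visits to `x` up to time `n`, for paths distributed as `ν`. -/
noncomputable def occupation (ν : Measure (ℕ → V)) (n : ℕ) (x : V) : ℝ≥0∞ :=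
  ∑ i ∈ Finset.range (n + 1), ν {ω | ω i = x}

theorem measure_visit_le_occupation (ν : Measure (ℕ → V)) {n i : ℕ} (hi : i ≤ n) (x : V) :
    ν {ω | ω i = x} ≤ occupation ν n x :=
  Finset.single_le_sum (f := fun i => ν {ω | ω i = x}) (fun _ _ => zero_le)
    (Finset.mem_range.2 (Nat.lt_succ_of_le hi))

theorem occupation_le (ν : Measure (ℕ → V)) (n : ℕ) (x : V) :
    occupation ν n x ≤ (n + 1) * ν Set.univ := by
  refine (Finset.sum_le_card_nsmul _ _ (ν Set.univ) fun i _ => measure_mono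
    (Set.subset_univ _)).trans ?_
  simp

theorem ae_occupation_ne_zero [Countable V] (ν : Measure (ℕ → V)) (n : ℕ) :
    ∀ᵐ ω ∂ν, ∀ i ≤ n, occupation ν n (ω i) ≠ 0 := by
  have h : ∀ᵐ ω ∂ν, ∀ (x : V) (i : ℕ), i ≤ n → occupation ν n x = 0 → ω i ≠ x := by
    refine ae_all_iff.2 fun x => ae_all_iff.2 fun i => ?_
    by_cases hc : i ≤ n ∧ occupation ν n x = 0
    · have h0 : ν {ω | ω i = x} = 0 :=
        le_antisymm ((measure_visit_le_occupation ν hc.1 x).trans hc.2.le) (zero_le)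
      exact measure_mono_null (fun ω hω => by simpa [hc.1, hc.2] using hω) h0
    · exact .of_forall fun ω h1 h2 => absurd ⟨h1, h2⟩ hc
  filter_upwards [h] with ω hω i hi h0
  exact hω _ i hi h0 rfl

variable [Countable V] [MeasurableSingletonClass V]

theorem lintegral_coordinate (ν : Measure (ℕ → V)) (n : ℕ) (f : V → ℝ≥0∞) :
    ∫⁻ ω, f (ω n) ∂ν = ∑' x, f x * ν {ω | ω n = x} := by
  rw [← lintegral_map (μ := ν) (f := f) Measurable.of_discrete (measurable_pi_apply n),
    lintegral_countable']
  refine tsum_congr fun x => ?_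
  rw [Measure.map_apply (measurable_pi_apply n) (measurableSet_singleton x)]
  rfl

theorem lintegral_sum_coordinate (ν : Measure (ℕ → V)) (n : ℕ) (f : V → ℝ≥0∞) :
    ∫⁻ ω, ∑ i ∈ Finset.range (n + 1), f (ω i) ∂ν = ∑' x, f x * occupation ν n x := by
  have hf : ∀ i ∈ Finset.range (n + 1), Measurable fun ω : ℕ → V => f (ω i) := fun i _ =>
    (Measurable.of_discrete (f := f)).comp (measurable_pi_apply i)
  rw [lintegral_finsetSum _ hf]
  simp_rw [lintegral_coordinate, occupation, Finset.mul_sum]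
  rw [Summable.tsum_finsetSum fun _ _ => ENNReal.summable]

theorem tsum_occupation (ν : Measure (ℕ → V)) (n : ℕ) :
    ∑' x, occupation ν n x = (n + 1) * ν Set.univ := by
  have := lintegral_sum_coordinate ν n (fun _ => 1)
  simpa using this.symm

end Occupation

/-- The tilting factor attached to the step from `x` to `y`. -/
noncomputable def tilt (α β γ : ℝ) (d : V → ℕ) (u : V → ℝ) (x y : V) : ℝ :=
  Real.exp (α * ((d y : ℝ) - d x) - γ) * (u y / u x) ^ β

theorem prod_tilt (α β γ : ℝ) (d : V → ℕ) (u : V → ℝ) (p : ℕ → V) (n : ℕ)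
    (hu : ∀ i ≤ n, 0 < u (p i)) :
    ∏ i ∈ Finset.range n, tilt α β γ d u (p i) (p (i + 1))
      = Real.exp (α * ((d (p n) : ℝ) - d (p 0)) - γ * n) * (u (p n) / u (p 0)) ^ β := by
  induction n with
  | zero => simp [div_self (hu 0 le_rfl).ne']
  | succ n ih =>
    have h0 := hu 0 (by omega)
    have h1 := hu n (by omega)
    have h2 := hu (n + 1) le_rfl
    rw [Finset.prod_range_succ, ih fun i hi => hu i (by omega), tilt, mul_mul_mul_comm,
      ← Real.exp_add, ← Real.mul_rpow (by positivity) (by positivity)]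
    congr 2
    · push_cast; ring
    · field_simp

theorem tilt_symm_le {ℓ κ β γ : ℝ} (hβ : 0 < β) (hβ1 : β < 1) (hγ : 0 ≤ γ)
    (h1 : (1 - β) * Real.exp κ + β * Real.exp (-κ - ℓ) ≤ Real.exp γ)
    (h2 : (1 - β) * Real.exp (-κ) + β * Real.exp (κ + ℓ) ≤ Real.exp γ)
    {d : V → ℕ} {u : V → ℝ} (hu : ∀ x, 0 ≤ u x) {x y : V}
    (hxy : d y ≤ d x + 1) (hyx : d x ≤ d y + 1) :
    u x * tilt (κ + β * ℓ) β γ d u x y + u y * tilt (κ + β * ℓ) β γ d u y x ≤ u x + u y := by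
  have key : ∀ a b δ : ℝ, 0 ≤ a → 0 ≤ b →
      a * (Real.exp ((κ + β * ℓ) * δ - γ) * (b / a) ^ β)
        = Real.exp (-γ) * (Real.exp ((κ + β * ℓ) * δ) * (a ^ (1 - β) * b ^ β)) := by
    intro a b δ ha hb
    rw [sub_eq_add_neg, add_comm, Real.exp_add]
    rcases ha.eq_or_lt with rfl | ha
    · simp [Real.zero_rpow (sub_pos.2 hβ1).ne']
    · rw [Real.div_rpow hb ha.le, Real.rpow_sub ha, Real.rpow_one]
      ring
  simp only [tilt]
  rw [key _ _ _ (hu x) (hu y), key _ _ _ (hu y) (hu x), ← mul_add, Real.exp_neg,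
    inv_mul_le_iff₀ (Real.exp_pos γ)]
  have hcases : d y = d x + 1 ∨ d x = d y + 1 ∨ d y = d x := by omega
  rcases hcases with h | h | h
  · have := weighted_edge_inequality hβ hβ1 h1 h2 (hu x) (hu y)
    rw [h]
    push_cast
    simpa using this
  · have := weighted_edge_inequality hβ hβ1 h1 h2 (hu y) (hu x)
    rw [h]
    push_cast
    rw [add_comm, add_comm (u x)]
    simpa using this
  · have := geom_symm_le hβ hβ1 (hu x) (hu y)
    have hx := hu x
    have hy := hu y
    rw [h]
    simp only [sub_self, mul_zero, Real.exp_zero, one_mul]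
    exact this.trans (le_mul_of_one_le_left (by positivity) (Real.one_le_exp hγ))

theorem tilted_weight_lower_bound {ℓ κ β γ : ℝ} (hβ : 0 < β) (hκ : 0 ≤ κ) {c a b t S : ℝ} {m k : ℕ}
    (hc : 0 < c) (ha : 0 < a) (hb : 0 < b) (hmk : m ≤ k) :
    Real.exp (κ * m - γ * t) * (c / a) ^ β * Real.exp (-1)
        * (β + t + 2 - (β * c * (Real.exp (-ℓ * k) / b) + S))
      ≤ Real.exp ((κ + β * ℓ) * k - γ * t) * (b / a) ^ β * Real.exp (t - S) := by
  have hlog := Real.one_sub_inv_le_log_of_pos (show 0 < b / (c * Real.exp (-ℓ * k)) by positivity)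
  rw [inv_div] at hlog
  have hb' : b ^ β = c ^ β * Real.exp (-ℓ * k * β)
      * Real.exp (Real.log (b / (c * Real.exp (-ℓ * k))) * β) := by
    rw [← Real.rpow_def_of_pos (by positivity), Real.exp_mul, ← Real.mul_rpow hc.le (by positivity),
      ← Real.mul_rpow (by positivity) (by positivity)]
    congr 1
    field_simp
  set N := β * c * (Real.exp (-ℓ * k) / b) + S with hN
  have hexp : Real.exp (-1) * (β + t + 2 - N) ≤ Real.exp (β + t - N) := by
    have := Real.add_one_le_exp (β + t - N + 1)
    rw [show β + t - N = -1 + (β + t - N + 1) by ring, Real.exp_add]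
    exact mul_le_mul_of_nonneg_left (by linarith) (Real.exp_pos _).le
  have hmk' : (m : ℝ) ≤ k := by exact_mod_cast hmk
  calc Real.exp (κ * m - γ * t) * (c / a) ^ β * Real.exp (-1) * (β + t + 2 - N)
      = Real.exp (κ * m - γ * t) * (c / a) ^ β * (Real.exp (-1) * (β + t + 2 - N)) := by ring
    _ ≤ Real.exp (κ * m - γ * t) * (c / a) ^ β *
          Real.exp (Real.log (b / (c * Real.exp (-ℓ * k))) * β + (t - S)) := by
        refine mul_le_mul_of_nonneg_left ?_ (by positivity)
        refine hexp.trans (Real.exp_le_exp.2 ?_)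
        have := mul_le_mul_of_nonneg_right hlog hβ.le
        have e : c * Real.exp (-ℓ * k) / b = c * (Real.exp (-ℓ * k) / b) := by ring
        rw [e] at this
        rw [hN]
        linarith
    _ ≤ Real.exp (κ * k - γ * t) * (c / a) ^ β *
          Real.exp (Real.log (b / (c * Real.exp (-ℓ * k))) * β + (t - S)) := by
        gcongr
    _ = Real.exp ((κ + β * ℓ) * k - γ * t) * (b / a) ^ β * Real.exp (t - S) := by
        rw [Real.div_rpow hb.le ha.le, Real.div_rpow hc.le ha.le, hb', Real.exp_add,
          show (κ + β * ℓ) * k - γ * t = (κ * k - γ * t) + -(-ℓ * k * β) by ring, Real.exp_add,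
          Real.exp_neg (-ℓ * k * β)]
        field_simp

/-- A bound for the probability that the walk is far from its starting point at time `T`. -/
theorem IsRandomWalk.measure_le_dist_le [Countable V] [MeasurableSpace V]
    [MeasurableSingletonClass V] {G : WeightedGraph V} {o : V} {μ : Measure (ℕ → V)}
    (hμ : IsRandomWalk G o μ) {d : V → ℕ} (hdo : d o = 0)
    (hd : ∀ x y, G.w x y ≠ 0 → d y ≤ d x + 1) {ℓ κ β γ : ℝ} (hκ : 0 ≤ κ) (hβ : 0 < β)
    (hβ1 : β < 1) (hγ : 0 ≤ γ)
    (h1 : (1 - β) * Real.exp κ + β * Real.exp (-κ - ℓ) ≤ Real.exp γ)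
    (h2 : (1 - β) * Real.exp (-κ) + β * Real.exp (κ + ℓ) ≤ Real.exp γ)
    {T m : ℕ} {W : ℝ} (hW : 0 < W)
    (hS : ∑' x, (if m ≤ d x then G.vw x * ENNReal.ofReal (Real.exp (-ℓ * d x)) else 0)
      ≤ ENNReal.ofReal W) :
    μ {ω | m ≤ d (ω T)} ≤ ENNReal.ofReal
      (Real.exp (1 + γ * T - κ * m) * (W * (T + 1) / (G.vw o).toReal) ^ β) := by
  have hprob := hμ.1
  set A : Set (ℕ → V) := {ω | m ≤ d (ω T)} with hA
  have hAm : MeasurableSet A :=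
    (MeasurableSet.of_discrete (s := {x : V | m ≤ d x})).preimage (measurable_pi_apply T)
  rcases eq_or_ne (μ A) 0 with h0 | h0
  · rw [h0]; exact zero_le
  set ν := μ.restrict A with hν
  have hνA : ν Set.univ = μ A := by simp [hν]
  set a := (μ A).toReal with ha
  have ha0 : 0 < a := ENNReal.toReal_pos h0 (measure_ne_top _ _)
  have haA : μ A = ENNReal.ofReal a := (ENNReal.ofReal_toReal (measure_ne_top _ _)).symm
  have hocc_top : ∀ x, occupation ν T x ≠ ⊤ := fun x =>
    ne_top_of_le_ne_top (by rw [hνA, haA]; finiteness) (occupation_le ν T x)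
  set u : V → ℝ := fun x => (occupation ν T x / G.vw x).toReal with hu
  have hu0 : ∀ x, 0 ≤ u x := fun x => ENNReal.toReal_nonneg
  have hocc : ∀ x, occupation ν T x = G.vw x * ENNReal.ofReal (u x) := fun x => by
    rw [hu, ENNReal.ofReal_toReal (ENNReal.div_ne_top (hocc_top x) (G.vw_ne_zero x)),
      ENNReal.mul_div_cancel (G.vw_ne_zero x) (G.vw_ne_top x)]
  have hupos : ∀ x, occupation ν T x ≠ 0 → 0 < u x := fun x hx => by
    rw [hocc] at hx
    exact ENNReal.ofReal_pos.1 (pos_iff_ne_zero.2 (right_ne_zero_of_mul hx))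
  set φ := tilt (κ + β * ℓ) β γ d u with hφ
  have hφ0 : ∀ x y, 0 ≤ φ x y := fun x y =>
    mul_nonneg (Real.exp_pos _).le (Real.rpow_nonneg (div_nonneg (hu0 _) (hu0 _)) _)
  set Λ : V → ℝ≥0∞ := fun x => ∑' y, G.trans x y * ENNReal.ofReal (φ x y) with hΛ
  have hΛsum : ∑' x, Λ x * occupation ν T x ≤ ENNReal.ofReal ((T + 1) * a) := by
    have e : ∀ x, Λ x * occupation ν T x = ∑' y, G.w x y * ENNReal.ofReal (u x * φ x y) := by
      intro x
      rw [hΛ, ← ENNReal.tsum_mul_right]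
      refine tsum_congr fun y => ?_
      rw [hocc, WeightedGraph.trans, ENNReal.ofReal_mul (hu0 x)]
      calc _ = G.w x y / G.vw x * G.vw x * (ENNReal.ofReal (u x) * ENNReal.ofReal (φ x y)) := by
            ring
        _ = _ := by rw [ENNReal.div_mul_cancel (G.vw_ne_zero x) (G.vw_ne_top x)]
    simp_rw [e]
    refine (G.tsum_edge_le _ (fun x => ENNReal.ofReal (u x)) fun x y hxy => ?_).trans ?_
    · rw [← ENNReal.ofReal_add (mul_nonneg (hu0 _) (hφ0 _ _)) (mul_nonneg (hu0 _) (hφ0 _ _)),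
        ← ENNReal.ofReal_add (hu0 _) (hu0 _)]
      exact ENNReal.ofReal_le_ofReal (tilt_symm_le hβ hβ1 hγ h1 h2 hu0 (hd x y hxy)
        (hd y x (by rwa [G.symm])))
    · simp_rw [← hocc]
      rw [tsum_occupation, hνA, haA, ENNReal.ofReal_mul (by positivity),
        ENNReal.ofReal_add (by positivity) zero_le_one]
      simp
  have hΛtop : ∀ x, Λ x ≠ ⊤ := by
    intro x
    by_cases hx : occupation ν T x = 0
    · have hux : u x = 0 := by simp [hu, hx]
      simp [hΛ, hφ, tilt, hux, Real.zero_rpow hβ.ne']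
    · intro htop
      have := (ENNReal.le_tsum x).trans hΛsum
      rw [htop, ENNReal.top_mul hx] at this
      exact absurd this (by simp)
  set L : V → ℝ := fun x => (Λ x).toReal with hL
  have hL0 : ∀ x, 0 ≤ L x := fun x => ENNReal.toReal_nonneg
  have hΛL : ∀ x, Λ x = ENNReal.ofReal (L x) := fun x => (ENNReal.ofReal_toReal (hΛtop x)).symm
  set k : V → V → ℝ≥0∞ := fun x y => ENNReal.ofReal (φ x y * Real.exp (1 - L x)) with hk
  have hk1 : ∀ x, ∑' y, G.trans x y * k x y ≤ 1 := by
    intro x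
    simp_rw [hk, fun y => ENNReal.ofReal_mul (q := Real.exp (1 - L x)) (hφ0 x y), ← mul_assoc]
    rw [ENNReal.tsum_mul_right]
    change Λ x * _ ≤ 1
    rw [hΛL, ← ENNReal.ofReal_mul (hL0 x), ENNReal.ofReal_le_one]
    have := Real.add_one_le_exp (L x - 1)
    calc L x * Real.exp (1 - L x) ≤ Real.exp (L x - 1) * Real.exp (1 - L x) := by
          gcongr; linarith
      _ = 1 := by rw [← Real.exp_add]; simp
  have hM : ∫⁻ ω, ∏ i ∈ Finset.range T, k (ω i) (ω (i + 1)) ∂ν ≤ 1 :=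
    (lintegral_mono' Measure.restrict_le_self le_rfl).trans (hμ.lintegral_prod_le_one k hk1 T)
  have hae : ∀ᵐ ω ∂ν, ω ∈ A ∧ ω 0 = o ∧ ∀ i ≤ T, 0 < u (ω i) := by
    filter_upwards [ae_restrict_mem hAm, ae_restrict_of_ae hμ.ae_start,
      ae_occupation_ne_zero ν T] with ω e1 e2 e3
    exact ⟨e1, e2, fun i hi => hupos _ (e3 i hi)⟩
  have huo : 0 < u o := by
    have : (ae ν).NeBot := by
      rw [ae_neBot]
      intro h
      rw [h] at hνA
      exact h0 hνA.symm
    obtain ⟨ω, -, e2, e3⟩ := hae.exists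
    rw [← e2]
    exact e3 0 (Nat.zero_le _)
  set c := a / W with hc
  have hc0 : 0 < c := by positivity
  set f : V → ℝ≥0∞ := fun x => ENNReal.ofReal (Real.exp (-ℓ * d x) / u x) with hf
  have hfint : ∫⁻ ω, f (ω T) ∂ν ≤ ENNReal.ofReal W := by
    rw [lintegral_coordinate]
    refine (ENNReal.tsum_le_tsum fun x => ?_).trans hS
    split_ifs with hx
    · refine (mul_le_mul_right (measure_visit_le_occupation ν le_rfl x) _).trans ?_
      rw [hocc, mul_left_comm, ← ENNReal.ofReal_mul (by have := hu0 x; positivity)]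
      refine mul_le_mul_right (ENNReal.ofReal_le_ofReal ?_) _
      rcases (hu0 x).eq_or_lt with h | h
      · rw [← h]; simp [(Real.exp_pos _).le]
      · rw [div_mul_cancel₀ _ h.ne']
    · have : ν {ω | ω T = x} = 0 := by
        rw [hν, Measure.restrict_apply' hAm]
        convert measure_empty (μ := μ)
        ext ω
        simp only [hA, Set.mem_inter_iff, Set.mem_ofPred_eq, Set.mem_empty_iff_false, iff_false]
        rintro ⟨rfl, h⟩
        exact hx h
      rw [this, mul_zero]
  set D := Real.exp (κ * m - γ * T) * (c / u o) ^ β * Real.exp (-1) with hD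
  have hD0 : 0 < D := by positivity
  have hpt : ∀ᵐ ω ∂ν, ENNReal.ofReal (D * (β + T + 2)) ≤
      ∏ i ∈ Finset.range T, k (ω i) (ω (i + 1)) + ENNReal.ofReal D *
        (ENNReal.ofReal (β * c) * f (ω T) + ∑ i ∈ Finset.range (T + 1), Λ (ω i)) := by
    filter_upwards [hae] with ω ⟨e1, e2, e3⟩
    have hf0 : 0 ≤ Real.exp (-ℓ * d (ω T)) / u (ω T) :=
      div_nonneg (Real.exp_pos _).le (hu0 _)
    have hprod : ∏ i ∈ Finset.range T, k (ω i) (ω (i + 1)) = ENNReal.ofReal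
        (Real.exp ((κ + β * ℓ) * d (ω T) - γ * T) * (u (ω T) / u o) ^ β
          * Real.exp (T - ∑ i ∈ Finset.range T, L (ω i))) := by
      rw [hk, ← ENNReal.ofReal_prod_of_nonneg
        (fun i _ => mul_nonneg (hφ0 _ _) (Real.exp_pos _).le), Finset.prod_mul_distrib, hφ,
        prod_tilt _ _ _ _ _ _ _ e3, ← Real.exp_sum, e2, hdo]
      simp
    have hsum : ∑ i ∈ Finset.range T, Λ (ω i) ≤ ∑ i ∈ Finset.range (T + 1), Λ (ω i) :=
      Finset.sum_le_sum_of_subset (Finset.range_mono (Nat.le_succ T))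
    refine le_trans ?_ (add_le_add_right (mul_le_mul_right (add_le_add_right hsum _) _) _)
    have hLs : 0 ≤ ∑ i ∈ Finset.range T, L (ω i) := Finset.sum_nonneg fun i _ => hL0 _
    simp_rw [hΛL]
    rw [hprod, ← ENNReal.ofReal_sum_of_nonneg (fun i _ => hL0 _), hf,
      ← ENNReal.ofReal_mul (by positivity), ← ENNReal.ofReal_add (by positivity) hLs,
      ← ENNReal.ofReal_mul hD0.le, ← ENNReal.ofReal_add (by have := hu0 (ω T); positivity)
        (by positivity)]
    refine ENNReal.ofReal_le_ofReal ?_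
    have := tilted_weight_lower_bound (ℓ := ℓ) (γ := γ) (t := T)
      (S := ∑ i ∈ Finset.range T, L (ω i)) hβ hκ hc0 huo (e3 T le_rfl) e1
    rw [← hD] at this
    linarith
  have hmeas : Measurable fun ω : ℕ → V => ENNReal.ofReal (β * c) * f (ω T) :=
    ((Measurable.of_discrete (f := f)).comp (measurable_pi_apply T)).const_mul _
  have hmeasΛ : Measurable fun ω : ℕ → V => ∑ i ∈ Finset.range (T + 1), Λ (ω i) :=
    Finset.measurable_fun_sum _ fun i _ =>
      (Measurable.of_discrete (f := Λ)).comp (measurable_pi_apply i)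
  have hmeasS : Measurable fun ω : ℕ → V =>
      ENNReal.ofReal (β * c) * f (ω T) + ∑ i ∈ Finset.range (T + 1), Λ (ω i) := hmeas.add hmeasΛ
  have hint := lintegral_mono_ae hpt
  rw [lintegral_const, hνA, haA, lintegral_add_right _ (hmeasS.const_mul _),
    lintegral_const_mul _ hmeasS, lintegral_add_left hmeas,
    lintegral_const_mul' _ _ ENNReal.ofReal_ne_top,
    lintegral_sum_coordinate] at hint
  replace hint := hint.trans (add_le_add hM (mul_le_mul_right
    (add_le_add (mul_le_mul_right hfint _) hΛsum) _))
  rw [← ENNReal.ofReal_mul (by positivity), ← ENNReal.ofReal_mul (by positivity),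
    ← ENNReal.ofReal_add (by positivity) (by positivity), ← ENNReal.ofReal_mul hD0.le,
    ← ENNReal.ofReal_one, ← ENNReal.ofReal_add zero_le_one (by positivity),
    ENNReal.ofReal_le_ofReal_iff (by positivity)] at hint
  have hcW : β * c * W = β * a := by rw [hc]; field_simp
  have hDa : D * a ≤ 1 := by rw [hcW] at hint; nlinarith
  have hvo : 0 < (G.vw o).toReal := ENNReal.toReal_pos (G.vw_ne_zero o) (G.vw_ne_top o)
  have huo_le : u o * (G.vw o).toReal ≤ (T + 1) * a := by
    have := occupation_le ν T o
    rw [hocc, hνA, haA] at this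
    have := ENNReal.toReal_mono (by finiteness) this
    rw [ENNReal.toReal_mul, ENNReal.toReal_mul, ENNReal.toReal_ofReal (hu0 o),
      ENNReal.toReal_ofReal ha0.le, ENNReal.toReal_add (by simp) (by simp)] at this
    simpa [mul_comm] using this
  rw [haA]
  refine ENNReal.ofReal_le_ofReal ?_
  have hratio : 1 ≤ c / u o * (W * (T + 1) / (G.vw o).toReal) := by
    have e : c / u o * (W * (T + 1) / (G.vw o).toReal) =
        (T + 1) * a / (u o * (G.vw o).toReal) := by rw [hc]; field_simp
    rw [e, one_le_div (by positivity)]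
    exact huo_le
  calc a ≤ a * (c / u o * (W * (T + 1) / (G.vw o).toReal)) ^ β :=
        le_mul_of_one_le_right ha0.le (Real.one_le_rpow hratio hβ.le)
    _ = D * a * (Real.exp (1 + γ * T - κ * m) * (W * (T + 1) / (G.vw o).toReal) ^ β) := by
        rw [Real.mul_rpow (by positivity) (by positivity), hD,
          show 1 + γ * T - κ * m = -((κ * m - γ * T) + (-1)) by ring,
          Real.exp_neg (κ * m - γ * T + -1), Real.exp_add (κ * m - γ * T)]
        field_simp
    _ ≤ 1 * (Real.exp (1 + γ * T - κ * m) * (W * (T + 1) / (G.vw o).toReal) ^ β) := by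
        gcongr
    _ = _ := one_mul _

theorem WeightedGraph.exists_nat_dist (G : WeightedGraph V) (o : V)
    (hconn : ∀ x, G.edist o x ≠ ⊤) :
    ∃ d : V → ℕ, (∀ x, G.edist o x = d x) ∧ d o = 0 ∧ ∀ x y, G.w x y ≠ 0 → d y ≤ d x + 1 := by
  set K : V → Set ℕ := fun x =>
    {k | ∃ p : ℕ → V, p 0 = o ∧ p k = x ∧ ∀ i, i < k → 0 < G.w (p i) (p (i + 1))} with hK
  have hne : ∀ x, (K x).Nonempty := by
    intro x
    by_contra h
    refine hconn x ?_
    simp only [WeightedGraph.edist, iInf_eq_top]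
    exact fun k hk => absurd ⟨k, hk⟩ h
  refine ⟨fun x => sInf (K x), fun x => ?_, ?_, fun x y hxy => ?_⟩
  · refine le_antisymm (iInf₂_le _ (Nat.sInf_mem (hne x))) (le_iInf₂ fun k hk => ?_)
    exact_mod_cast Nat.sInf_le (s := K x) hk
  · exact Nat.le_zero.1 (Nat.sInf_le ⟨fun _ => o, rfl, rfl, by simp⟩)
  · obtain ⟨p, hp0, hpx, hp⟩ := Nat.sInf_mem (hne x)
    beta_reduce
    generalize sInf (K x) = k at hpx hp ⊢
    refine Nat.sInf_le ⟨fun i => if i ≤ k then p i else y, by simp [hp0], by simp, fun i hi => ?_⟩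
    rcases Nat.lt_succ_iff_lt_or_eq.1 hi with h | rfl
    · simpa only [h.le, Nat.succ_le_of_lt h, if_true] using hp i h
    · simpa [hpx] using pos_iff_ne_zero.2 hxy

theorem WeightedGraph.tsum_vw_exp_le (G : WeightedGraph V) {o : V} {d : V → ℕ}
    (hdist : ∀ x, G.edist o x = d x) (hd : ∀ x y, G.w x y ≠ 0 → d y ≤ d x + 1) {ℓ : ℝ}
    (hℓ : 0 ≤ ℓ) (N : ℕ) :
    ∑' x, (if N + 1 ≤ d x then G.vw x * ENNReal.ofReal (Real.exp (-ℓ * d x)) else 0)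
      ≤ ∑' n : ℕ, if N ≤ n then
          G.boundaryWeight o n * ENNReal.ofReal (Real.exp (-ℓ * n)) else 0 := by
  set F : ℕ → V × V → ℝ≥0∞ := fun n q => if N ≤ n then
    (if min (G.edist o q.1) (G.edist o q.2) = (n : ℝ≥0∞) then G.w q.1 q.2 else 0)
      * ENNReal.ofReal (Real.exp (-ℓ * n)) else 0 with hF
  have hR : ∀ n : ℕ, (if N ≤ n then
      G.boundaryWeight o n * ENNReal.ofReal (Real.exp (-ℓ * n)) else 0) = ∑' q, F n q := by
    intro n
    by_cases h : N ≤ n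
    · simp only [hF, h, boundaryWeight, if_true, ENNReal.tsum_mul_right]
    · simp [hF, h]
  have hLft : ∀ x, (if N + 1 ≤ d x then G.vw x * ENNReal.ofReal (Real.exp (-ℓ * d x)) else 0)
      = ∑' y, if N + 1 ≤ d x then G.w x y * ENNReal.ofReal (Real.exp (-ℓ * d x)) else 0 := by
    intro x
    split_ifs
    · rw [vw, ENNReal.tsum_mul_right]
    · simp
  simp_rw [hR, hLft]
  rw [ENNReal.tsum_comm (α := ℕ), ENNReal.tsum_prod']
  refine ENNReal.tsum_le_tsum fun x => ENNReal.tsum_le_tsum fun y => ?_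
  split_ifs with hx
  · by_cases hw : G.w x y = 0
    · simp [hw]
    · have h1 := hd y x (by rwa [G.symm])
      have h2 : N ≤ min (d x) (d y) := by omega
      refine le_trans ?_ (ENNReal.le_tsum (min (d x) (d y)))
      have h3 : min (G.edist o x) (G.edist o y) = ((min (d x) (d y) : ℕ) : ℝ≥0∞) := by
        rw [hdist, hdist, (Nat.mono_cast (α := ℝ≥0∞)).map_min]
      simp only [hF, h2, h3, if_true]
      refine mul_le_mul_right (ENNReal.ofReal_le_ofReal (Real.exp_le_exp.2 ?_)) _
      have : ((min (d x) (d y) : ℕ) : ℝ) ≤ d x := by exact_mod_cast min_le_left _ _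
      nlinarith
  · exact zero_le

theorem WeightedGraph.exists_tsum_vw_exp_le (G : WeightedGraph V) {o : V} {d : V → ℕ}
    (hdist : ∀ x, G.edist o x = d x) (hd : ∀ x y, G.w x y ≠ 0 → d y ≤ d x + 1) {g g' : ℝ}
    (hg : 1 ≤ g) (hgg' : g < g')
    (hgrowth : limsup (fun n : ℕ => G.boundaryWeight o n ^ ((n : ℝ)⁻¹)) atTop
      ≤ ENNReal.ofReal g) :
    ∃ (N : ℕ) (W : ℝ), 0 < W ∧ ∑' x, (if N ≤ d x then
      G.vw x * ENNReal.ofReal (Real.exp (-Real.log g' * d x)) else 0) ≤ ENNReal.ofReal W := by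
  obtain ⟨r, hgr, hrg'⟩ := exists_between hgg'
  have hr0 : 0 < r := by linarith
  have hg'0 : 0 < g' := by linarith
  have hev := eventually_lt_of_limsup_lt
    (hgrowth.trans_lt ((ENNReal.ofReal_lt_ofReal_iff hr0).2 hgr))
  obtain ⟨N, hN⟩ := eventually_atTop.1 (hev.and (eventually_gt_atTop 0))
  have hb : ∀ n ≥ N, G.boundaryWeight o n ≤ ENNReal.ofReal (r ^ n) := by
    intro n hn
    obtain ⟨h1, h2⟩ := hN n hn
    have h := ENNReal.rpow_le_rpow h1.le (Nat.cast_nonneg n)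
    rwa [← ENNReal.rpow_mul, inv_mul_cancel₀ (by positivity), ENNReal.rpow_one,
      ENNReal.rpow_natCast, ← ENNReal.ofReal_pow hr0.le] at h
  have hsum : Summable fun n : ℕ => (r / g') ^ n :=
    summable_geometric_of_lt_one (by positivity) ((div_lt_one hg'0).2 hrg')
  refine ⟨N + 1, ∑' n : ℕ, (r / g') ^ n, hsum.tsum_pos (fun n => by positivity) 0 (by simp),
    (G.tsum_vw_exp_le hdist hd (Real.log_nonneg (by linarith)) N).trans ?_⟩
  rw [ENNReal.ofReal_tsum_of_nonneg (fun n => by positivity) hsum]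
  refine ENNReal.tsum_le_tsum fun n => ?_
  split_ifs with hn
  · refine (mul_le_mul_left (hb n hn) _).trans ?_
    rw [← ENNReal.ofReal_mul (by positivity)]
    refine ENNReal.ofReal_le_ofReal (le_of_eq ?_)
    rw [mul_comm (-_), mul_neg, Real.exp_neg, mul_comm, Real.exp_mul, Real.rpow_def_of_pos
      (Real.exp_pos _), Real.log_exp, mul_comm (n : ℝ), ← Real.rpow_def_of_pos hg'0,
      Real.rpow_natCast, div_pow]
    field_simp
  · exact zero_le

theorem IsRandomWalk.ae_eventually_dist_lt [Countable V] [MeasurableSpace V]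
    [MeasurableSingletonClass V] {G : WeightedGraph V} {o : V} {μ : Measure (ℕ → V)}
    (hμ : IsRandomWalk G o μ) {d : V → ℕ} (hdist : ∀ x, G.edist o x = d x) (hdo : d o = 0)
    (hd : ∀ x y, G.w x y ≠ 0 → d y ≤ d x + 1) {g v : ℝ} (hg : 1 ≤ g)
    (hgrowth : limsup (fun n : ℕ => G.boundaryWeight o n ^ ((n : ℝ)⁻¹)) atTop
      ≤ ENNReal.ofReal g) (hv : (g - 1) / (g + 1) < v) :
    ∀ᵐ ω ∂μ, ∀ᶠ T : ℕ in atTop, (d (ω T) : ℝ) < v * T := by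
  have hv0 : 0 < v := lt_of_le_of_lt (div_nonneg (by linarith) (by linarith)) hv
  obtain ⟨g', hg'v, hgg'⟩ : ∃ g', (g' - 1) / (g' + 1) < v ∧ g < g' := by
    have hcont : ContinuousAt (fun t : ℝ => (t - 1) / (t + 1)) g :=
      (continuousAt_id.sub continuousAt_const).div (continuousAt_id.add continuousAt_const)
        (show g + 1 ≠ 0 by linarith)
    exact (((hcont.eventually_lt continuousAt_const hv).filter_mono
      nhdsWithin_le_nhds).and (self_mem_nhdsWithin (s := Set.Ioi g))).exists
  obtain ⟨κ, β, γ, hκ, hβ, hβ1, hγ, hγκ, h1, h2⟩ := exists_tilting_parameters (by linarith) hg'v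
  obtain ⟨N, W, hW, hNW⟩ := G.exists_tsum_vw_exp_le hdist hd hg hgg' hgrowth
  have hvo : 0 < (G.vw o).toReal := ENNReal.toReal_pos (G.vw_ne_zero o) (G.vw_ne_top o)
  set C := Real.exp 1 * (W / (G.vw o).toReal) ^ β with hC
  set q := Real.exp (-(κ * v - γ)) with hq
  have hq1 : q < 1 := by rw [hq, ← Real.exp_zero, Real.exp_lt_exp]; linarith
  have hq0 : 0 < q := Real.exp_pos _
  have hsum : Summable fun T : ℕ => C * (((T : ℝ) + 1) * q ^ T) := by
    refine Summable.mul_left _ ?_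
    have hn : ‖q‖ < 1 := by rwa [Real.norm_of_nonneg hq0.le]
    have := (summable_pow_mul_geometric_of_norm_lt_one 1 hn).add
      (summable_geometric_of_norm_lt_one hn)
    simpa [add_mul] using this
  obtain ⟨T₀, hT₀⟩ := exists_nat_ge (N / v)
  set s : ℕ → Set (ℕ → V) := fun T => {ω | T₀ ≤ T ∧ v * T ≤ d (ω T)} with hs
  have hbound : ∀ T, μ (s T) ≤ ENNReal.ofReal (C * (((T : ℝ) + 1) * q ^ T)) := by
    intro T
    by_cases hT : T₀ ≤ T
    · have hsub : s T ⊆ {ω | ⌈v * T⌉₊ ≤ d (ω T)} := fun ω hω => Nat.ceil_le.2 hω.2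
      have hNm : N ≤ ⌈v * T⌉₊ := by
        have hT' : (T₀ : ℝ) ≤ T := by exact_mod_cast hT
        have : (N : ℝ) ≤ v * T := by
          rw [← div_le_iff₀' hv0]
          exact hT₀.trans hT'
        exact_mod_cast this.trans (Nat.le_ceil _)
      have hS : ∑' x, (if ⌈v * T⌉₊ ≤ d x then
          G.vw x * ENNReal.ofReal (Real.exp (-Real.log g' * d x)) else 0)
          ≤ ENNReal.ofReal W := by
        refine (ENNReal.tsum_le_tsum fun x => ?_).trans hNW
        split_ifs with e1 e2
        · exact le_rfl
        · exact absurd (hNm.trans e1) e2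
        · exact zero_le
        · exact le_rfl
      refine (measure_mono hsub).trans
        ((hμ.measure_le_dist_le hdo hd hκ.le hβ hβ1 hγ h1 h2 hW hS).trans
          (ENNReal.ofReal_le_ofReal ?_))
      have e1 : Real.exp (1 + γ * T - κ * ⌈v * T⌉₊) ≤ Real.exp 1 * q ^ T := by
        rw [hq, ← Real.exp_nat_mul, ← Real.exp_add, Real.exp_le_exp]
        have := mul_le_mul_of_nonneg_left (Nat.le_ceil (v * T)) hκ.le
        linarith
      have e2 : (W * (T + 1) / (G.vw o).toReal) ^ β
          ≤ (W / (G.vw o).toReal) ^ β * ((T : ℝ) + 1) := by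
        rw [mul_div_right_comm, Real.mul_rpow (by positivity) (by positivity)]
        gcongr
        calc ((T : ℝ) + 1) ^ β ≤ ((T : ℝ) + 1) ^ (1 : ℝ) :=
              Real.rpow_le_rpow_of_exponent_le (by simp) hβ1.le
          _ = _ := Real.rpow_one _
      calc _ ≤ (Real.exp 1 * q ^ T) * ((W / (G.vw o).toReal) ^ β * ((T : ℝ) + 1)) := by gcongr
        _ = _ := by rw [hC]; ring
    · simp [hs, hT]
  have hfin : ∑' T, μ (s T) ≠ ⊤ := by
    refine ne_top_of_le_ne_top ?_ (ENNReal.tsum_le_tsum hbound)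
    rw [← ENNReal.ofReal_tsum_of_nonneg (fun T => by positivity) hsum]
    exact ENNReal.ofReal_ne_top
  filter_upwards [ae_eventually_notMem hfin] with ω hω
  filter_upwards [hω, eventually_ge_atTop T₀] with T hT hT'
  by_contra h
  exact hT ⟨hT', not_lt.1 h⟩

/-- Exponential growth and lim sup speed: if the exponential upper growth
`limsup wₙ^{1/n}` of an infinite connected weighted graph is at most `g` with `g ≥ 1`, then
almost surely `limsup |X_k|/k ≤ (g-1)/(g+1)`. -/
theorem limsup_speed_bound
    {V : Type*} [Countable V] [Infinite V] [MeasurableSpace V] [MeasurableSingletonClass V]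
    (G : WeightedGraph V) (o : V) (hconn : ∀ x, G.edist o x ≠ ⊤)
    (μ : Measure (ℕ → V)) (hμ : IsRandomWalk G o μ)
    (g : ℝ) (hg : 1 ≤ g)
    (hgrowth : Filter.limsup (fun n : ℕ => G.boundaryWeight o n ^ ((n : ℝ)⁻¹)) atTop
        ≤ ENNReal.ofReal g) :
    ∀ᵐ ω ∂μ,
      Filter.limsup (fun k : ℕ => (G.edist o (ω k)).toReal / k) atTop ≤ (g - 1) / (g + 1) := by
  obtain ⟨d, hdist, hdo, hd⟩ := G.exists_nat_dist o hconn
  have hall : ∀ᵐ ω ∂μ, ∀ n : ℕ, ∀ᶠ T : ℕ in atTop,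
      (d (ω T) : ℝ) < ((g - 1) / (g + 1) + 1 / ((n : ℝ) + 1)) * T :=
    ae_all_iff.2 fun n => hμ.ae_eventually_dist_lt hdist hdo hd hg hgrowth
      (lt_add_of_pos_right _ (by positivity))
  filter_upwards [hall] with ω hω
  refine le_of_forall_pos_le_add fun ε hε => ?_
  obtain ⟨n, hn⟩ := exists_nat_one_div_lt hε
  have hcob : IsCoboundedUnder (· ≤ ·) atTop
      fun k : ℕ => (G.edist o (ω k)).toReal / k :=
    (isBoundedUnder_of_eventually_ge (a := 0)
      (.of_forall fun k => by positivity)).isCoboundedUnder_le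
  refine limsup_le_of_le hcob ?_
  filter_upwards [hω n, eventually_gt_atTop 0] with T hT hT0
  have hT0' : (0 : ℝ) < T := by exact_mod_cast hT0
  rw [hdist, ENNReal.toReal_natCast, div_le_iff₀ hT0']
  exact hT.le.trans (by gcongr)

end RWHitting
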